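/- arXiv:1601.06269 — 2 statements merged into one kernel-verified Lean document; each statement's English description precedes it below -/
import Mathlib

section
/- Let x ∈ ℂ^n be a unit vector such that |x⟩⟨x| is not diagonal, let D be an incoherent state, let v be a unit eigenvector of |x⟩⟨x| − D corresponding to its largest eigenvalue, and let F = { F : F is a diagonal n×n matrix with real diagonal entries f_1, …, f_n satisfying ∑_j f_j = 0 and f_j ≤ D_{jj} for all j }. Then the following are equivalent: (a) ‖|x⟩⟨x| − D‖_tr = min over all incoherent states δ of ‖|x⟩⟨x| − δ‖_tr; (b) ‖|x⟩⟨x| − D‖ = min over all incoherent states δ of ‖|x⟩⟨x| − δ‖; (c) ⟨v| F |v⟩ ≥ 0 for every F ∈ F. -/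
open Matrix BigOperators
open scoped ComplexOrder

/-- The trace norm of a Hermitian matrix: the sum of the absolute values of its
eigenvalues (junk value `0` for non-Hermitian matrices). -/
noncomputable def traceNorm {m : Type*} [Fintype m] [DecidableEq m] (A : Matrix m m ℂ) : ℝ :=
  if h : A.IsHermitian then ∑ i, |h.eigenvalues i| else 0

/-- The operator norm of a Hermitian matrix: the maximum of the absolute values of its
eigenvalues (junk value `0` for non-Hermitian matrices). -/
noncomputable def opNorm {m : Type*} [Fintype m] [DecidableEq m] (A : Matrix m m ℂ) : ℝ :=
  if h : A.IsHermitian then ⨆ i, |h.eigenvalues i| else 0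

/-- A density matrix: positive semidefinite with trace 1. -/
def IsDensity {m : Type*} [Fintype m] (A : Matrix m m ℂ) : Prop :=
  A.PosSemidef ∧ A.trace = 1

/-- An incoherent state: a diagonal density matrix. -/
def IsIncoherent {m : Type*} [Fintype m] [DecidableEq m] (A : Matrix m m ℂ) : Prop :=
  IsDensity A ∧ ∀ i j, i ≠ j → A i j = 0

/-- `|x⟩⟨x|`, the rank-one matrix with `(i,j)` entry `x i * conj (x j)`. -/
def outer {m : Type*} (x : m → ℂ) : Matrix m m ℂ :=
  Matrix.of fun i j => x i * star (x j)

namespace Matrix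

variable {m : Type*} [Fintype m]

theorem IsHermitian.star_dotProduct_mulVec {A : Matrix m m ℂ} (hA : A.IsHermitian) (u w : m → ℂ) :
    star u ⬝ᵥ A *ᵥ w = star (A *ᵥ u) ⬝ᵥ w := by
  rw [star_mulVec, dotProduct_mulVec, hA.eq]

theorem star_dotProduct_self_eq_sum (u : m → ℂ) :
    star u ⬝ᵥ u = ((∑ i, ‖u i‖ ^ 2 : ℝ) : ℂ) := by
  simp [dotProduct, Complex.conj_mul']

theorem star_dotProduct_diagonal_mulVec [DecidableEq m] (f : m → ℝ) (u : m → ℂ) :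
    star u ⬝ᵥ (diagonal fun j => (f j : ℂ)) *ᵥ u = ((∑ i, f i * ‖u i‖ ^ 2 : ℝ) : ℂ) := by
  simp only [dotProduct, mulVec_diagonal, Pi.star_apply, RCLike.star_def, Complex.ofReal_sum,
    Complex.ofReal_mul, Complex.ofReal_pow, ← Complex.conj_mul']
  exact Finset.sum_congr rfl fun i _ => by ring

theorem IsHermitian.re_dotProduct_mulVec_nonpos_of_orthogonal {A : Matrix m m ℂ}
    (hA : A.IsHermitian) {x v w : m → ℂ} {μ : ℝ} (hμ : 0 < μ) (hv : star v ⬝ᵥ v = 1)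
    (hev : A *ᵥ v = (μ : ℂ) • v)
    (hneg : ∀ y, star x ⬝ᵥ y = 0 → (star y ⬝ᵥ A *ᵥ y).re ≤ 0) (hvw : star v ⬝ᵥ w = 0) :
    (star w ⬝ᵥ A *ᵥ w).re ≤ 0 := by
  have hwv : star w ⬝ᵥ v = 0 := by rw [star_dotProduct, hvw, star_zero]
  have hvAw : star v ⬝ᵥ A *ᵥ w = 0 := by
    rw [hA.star_dotProduct_mulVec, hev, star_smul, smul_dotProduct, hvw, smul_zero]
  set a := star x ⬝ᵥ w
  set b := star x ⬝ᵥ v with hb_def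
  have hb : b ≠ 0 := by
    intro hb
    have := hneg v hb
    rw [hev, dotProduct_smul, hv] at this
    simp at this
    linarith
  have key := hneg (a • v - b • w) (by
    rw [dotProduct_sub, dotProduct_smul, dotProduct_smul, smul_eq_mul, smul_eq_mul]
    ring)
  have hexp : star (a • v - b • w) ⬝ᵥ A *ᵥ (a • v - b • w)
      = ((‖a‖ ^ 2 * μ : ℝ) : ℂ) + ((‖b‖ ^ 2 : ℝ) : ℂ) * (star w ⬝ᵥ A *ᵥ w) := by
    simp only [mulVec_sub, mulVec_smul, star_sub, star_smul, sub_dotProduct, dotProduct_sub,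
      smul_dotProduct, dotProduct_smul, hvAw, hev, hwv, hv, smul_eq_mul]
    push_cast
    rw [← Complex.conj_mul', ← Complex.conj_mul']
    simp only [RCLike.star_def]
    ring
  rw [hexp, Complex.add_re, Complex.ofReal_re, Complex.re_ofReal_mul] at key
  have h1 : 0 ≤ ‖a‖ ^ 2 * μ := by positivity
  have h2 : 0 < ‖b‖ ^ 2 := by positivity
  by_contra! h
  nlinarith [mul_pos h2 h]

theorem exists_orthogonal_decomposition {v : m → ℂ} (hv : star v ⬝ᵥ v = 1) (u : m → ℂ) :
    ∃ (c : ℂ) (w : m → ℂ), u = c • v + w ∧ star v ⬝ᵥ w = 0 ∧ star w ⬝ᵥ v = 0 ∧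
      ∑ i, ‖u i‖ ^ 2 = ‖c‖ ^ 2 + ∑ i, ‖w i‖ ^ 2 := by
  have hvw : star v ⬝ᵥ (u - (star v ⬝ᵥ u) • v) = 0 := by
    rw [dotProduct_sub, dotProduct_smul, hv, smul_eq_mul, mul_one, sub_self]
  generalize hc : star v ⬝ᵥ u = c at hvw
  generalize hw : u - c • v = w at hvw
  have hu : u = c • v + w := by rw [← hw]; abel
  have hwv : star w ⬝ᵥ v = 0 := by rw [star_dotProduct, hvw, star_zero]
  refine ⟨c, w, hu, hvw, hwv, ?_⟩
  rw [← Complex.ofReal_inj, ← star_dotProduct_self_eq_sum, Complex.ofReal_add,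
    ← star_dotProduct_self_eq_sum, hu]
  simp only [star_add, star_smul, add_dotProduct, dotProduct_add, smul_dotProduct,
    dotProduct_smul, hvw, hwv, hv, smul_eq_mul]
  push_cast
  rw [← Complex.conj_mul']
  simp only [RCLike.star_def]
  ring

theorem IsHermitian.dotProduct_mulVec_add_of_orthogonal {A : Matrix m m ℂ}
    (hA : A.IsHermitian) {v w : m → ℂ} {μ : ℝ} (hv : star v ⬝ᵥ v = 1)
    (hev : A *ᵥ v = (μ : ℂ) • v) (hvw : star v ⬝ᵥ w = 0) (hwv : star w ⬝ᵥ v = 0) (c : ℂ) :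
    (star (c • v + w) ⬝ᵥ A *ᵥ (c • v + w)).re = μ * ‖c‖ ^ 2 + (star w ⬝ᵥ A *ᵥ w).re := by
  have hvAw : star v ⬝ᵥ A *ᵥ w = 0 := by
    rw [hA.star_dotProduct_mulVec, hev, star_smul, smul_dotProduct, hvw, smul_zero]
  have hexp : star (c • v + w) ⬝ᵥ A *ᵥ (c • v + w)
      = ((μ * ‖c‖ ^ 2 : ℝ) : ℂ) + star w ⬝ᵥ A *ᵥ w := by
    simp only [mulVec_add, mulVec_smul, star_add, star_smul, add_dotProduct, dotProduct_add,
      smul_dotProduct, dotProduct_smul, hvAw, hev, hwv, hv, smul_eq_mul]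
    push_cast
    rw [← Complex.conj_mul']
    simp only [RCLike.star_def]
    ring
  rw [hexp, Complex.add_re, Complex.ofReal_re]

theorem re_dotProduct_outer_sub_mulVec_nonpos {D : Matrix m m ℂ} (hD : D.PosSemidef)
    {x y : m → ℂ} (hxy : star x ⬝ᵥ y = 0) : (star y ⬝ᵥ (outer x - D) *ᵥ y).re ≤ 0 := by
  have h1 : outer x *ᵥ y = 0 := by
    ext i
    have : (outer x *ᵥ y) i = x i * (star x ⬝ᵥ y) := by
      simp [outer, mulVec, dotProduct, Finset.mul_sum, mul_assoc]
    rw [this, hxy, mul_zero, Pi.zero_apply]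
  rw [sub_mulVec, h1, zero_sub, dotProduct_neg, Complex.neg_re]
  have := (Complex.le_def.1 (hD.dotProduct_mulVec_nonneg y)).1
  simpa using this

theorem re_dotProduct_outer_sub_mulVec_le {D : Matrix m m ℂ} (hD : D.PosSemidef)
    {x u : m → ℂ} (hA : (outer x - D).IsHermitian) {μ : ℝ} (hμ : 0 < μ)
    (hu : star u ⬝ᵥ u = 1) (hev : (outer x - D) *ᵥ u = (μ : ℂ) • u) (v : m → ℂ)
    (hv : ∑ i, ‖v i‖ ^ 2 = 1) : (star v ⬝ᵥ (outer x - D) *ᵥ v).re ≤ μ := by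
  obtain ⟨c, w, rfl, huw, hwu, hsum⟩ := exists_orthogonal_decomposition hu v
  rw [hA.dotProduct_mulVec_add_of_orthogonal hu hev huw hwu]
  have h1 := hA.re_dotProduct_mulVec_nonpos_of_orthogonal hμ hu hev
    (fun y hy => re_dotProduct_outer_sub_mulVec_nonpos hD hy) huw
  have h2 : 0 ≤ ∑ i, ‖w i‖ ^ 2 := by positivity
  have h3 : ‖c‖ ^ 2 ≤ 1 := by linarith
  nlinarith

theorem IsHermitian.star_eigenvectorBasis_dotProduct [DecidableEq m] {A : Matrix m m ℂ}
    (hA : A.IsHermitian) (i j : m) :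
    star (⇑(hA.eigenvectorBasis i)) ⬝ᵥ ⇑(hA.eigenvectorBasis j) = if i = j then 1 else 0 := by
  rw [dotProduct_comm, ← EuclideanSpace.inner_eq_star_dotProduct]
  exact hA.eigenvectorBasis.inner_eq_ite i j

theorem IsHermitian.mulVec_eigenvectorBasis_coe [DecidableEq m] {A : Matrix m m ℂ}
    (hA : A.IsHermitian) (j : m) :
    A *ᵥ ⇑(hA.eigenvectorBasis j) = (hA.eigenvalues j : ℂ) • ⇑(hA.eigenvectorBasis j) :=
  hA.mulVec_eigenvectorBasis j

end Matrix

section Incoherent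

theorem outer_isHermitian {m : Type*} (x : m → ℂ) : (outer x).IsHermitian := by
  ext i j
  simp [outer, mul_comm]

variable {m : Type*} [Fintype m]

theorem trace_outer {x : m → ℂ} (hx : ∑ i, ‖x i‖ ^ 2 = 1) : (outer x).trace = 1 := by
  have : (outer x).trace = star x ⬝ᵥ x := by
    simp [trace, outer, dotProduct, mul_comm]
  rw [this, star_dotProduct_self_eq_sum, hx, Complex.ofReal_one]

variable [DecidableEq m]

theorem IsIncoherent.outer_sub_isHermitian {D : Matrix m m ℂ} (hD : IsIncoherent D) (x : m → ℂ) :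
    (outer x - D).IsHermitian :=
  (outer_isHermitian x).sub hD.1.1.isHermitian

theorem IsIncoherent.eq_diagonal {D : Matrix m m ℂ} (hD : IsIncoherent D) :
    D = diagonal fun j => D j j := by
  ext i j
  by_cases hij : i = j
  · subst hij; simp
  · rw [hD.2 i j hij, diagonal_apply_ne _ hij]

theorem isIncoherent_diagonal {d : m → ℂ} (h0 : ∀ j, 0 ≤ d j) (h1 : ∑ j, d j = 1) :
    IsIncoherent (diagonal d) :=
  ⟨⟨posSemidef_diagonal_iff.2 h0, by rwa [trace_diagonal]⟩, fun _ _ h => diagonal_apply_ne _ h⟩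

theorem IsIncoherent.sum_eigenvalues {D : Matrix m m ℂ} (hD : IsIncoherent D) {x : m → ℂ}
    (hx : ∑ i, ‖x i‖ ^ 2 = 1) (h : (outer x - D).IsHermitian) : ∑ i, h.eigenvalues i = 0 := by
  have h1 := h.trace_eq_sum_eigenvalues
  rw [trace_sub, trace_outer hx, hD.1.2, sub_self, ← Complex.ofReal_zero] at h1
  have h2 := congrArg Complex.re h1
  simpa using h2.symm

theorem IsIncoherent.pos_of_isGreatest {D : Matrix m m ℂ} (hD : IsIncoherent D) {x : m → ℂ}
    (hx : ∑ i, ‖x i‖ ^ 2 = 1) (hnd : ¬ ∃ dvec : m → ℂ, outer x = diagonal dvec)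
    (h : (outer x - D).IsHermitian) {μ : ℝ} (hμ : IsGreatest (Set.range h.eigenvalues) μ) :
    0 < μ := by
  by_contra! hle
  have hall : ∀ i, h.eigenvalues i ≤ 0 := fun i => (hμ.2 ⟨i, rfl⟩).trans hle
  have hzero : h.eigenvalues = 0 := by
    ext i
    exact (Finset.sum_eq_zero_iff_of_nonpos fun i _ => hall i).1 (hD.sum_eigenvalues hx h) i
      (Finset.mem_univ i)
  exact hnd ⟨_, (sub_eq_zero.1 (h.eigenvalues_eq_zero_iff.1 hzero)).trans hD.eq_diagonal⟩

theorem IsIncoherent.norms_eq_of_isGreatest {D : Matrix m m ℂ} (hD : IsIncoherent D) {x : m → ℂ}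
    (hx : ∑ i, ‖x i‖ ^ 2 = 1) (h : (outer x - D).IsHermitian) {μ : ℝ} (hpos : 0 < μ)
    (hμ : IsGreatest (Set.range h.eigenvalues) μ) :
    traceNorm (outer x - D) = 2 * μ ∧ opNorm (outer x - D) = μ := by
  obtain ⟨⟨k, rfl⟩, hmax⟩ := hμ
  have hothers : ∀ i, i ≠ k → h.eigenvalues i ≤ 0 := by
    intro i hi
    have := h.re_dotProduct_mulVec_nonpos_of_orthogonal (w := ⇑(h.eigenvectorBasis i)) hpos
      (by simp [h.star_eigenvectorBasis_dotProduct]) (h.mulVec_eigenvectorBasis_coe k)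
      (fun y hy => re_dotProduct_outer_sub_mulVec_nonpos hD.1.1 hy)
      (by simp [h.star_eigenvectorBasis_dotProduct, hi.symm])
    simpa [h.mulVec_eigenvectorBasis_coe, h.star_eigenvectorBasis_dotProduct] using this
  have habs : ∑ i ∈ Finset.univ.erase k, |h.eigenvalues i| = h.eigenvalues k := by
    have h1 := hD.sum_eigenvalues hx h
    rw [← Finset.add_sum_erase _ _ (Finset.mem_univ k)] at h1
    rw [Finset.sum_congr rfl fun i hi => abs_of_nonpos (hothers i (Finset.ne_of_mem_erase hi)),
      Finset.sum_neg_distrib]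
    linarith
  have hle : ∀ i, |h.eigenvalues i| ≤ h.eigenvalues k := by
    intro i
    by_cases hi : i = k
    · rw [hi, abs_of_pos hpos]
    · rw [← habs]
      exact Finset.single_le_sum (f := fun i => |h.eigenvalues i|) (fun _ _ => abs_nonneg _)
        (Finset.mem_erase.2 ⟨hi, Finset.mem_univ i⟩)
  constructor
  · rw [traceNorm, dif_pos h, ← Finset.add_sum_erase _ _ (Finset.mem_univ k), habs,
      abs_of_pos hpos]
    ring
  · rw [opNorm, dif_pos h]
    have : Nonempty m := ⟨k⟩
    refine le_antisymm (ciSup_le hle) ?_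
    exact (le_abs_self _).trans
      (le_ciSup (f := fun i => |h.eigenvalues i|) (Set.finite_range _).bddAbove k)

theorem IsIncoherent.exists_eigenvector {D : Matrix m m ℂ} (hD : IsIncoherent D) {x : m → ℂ}
    (hx : ∑ i, ‖x i‖ ^ 2 = 1) (hnd : ¬ ∃ dvec : m → ℂ, outer x = diagonal dvec) :
    ∃ (μ : ℝ) (u : m → ℂ), 0 < μ ∧ star u ⬝ᵥ u = 1 ∧ (outer x - D) *ᵥ u = (μ : ℂ) • u ∧
      traceNorm (outer x - D) = 2 * μ ∧ opNorm (outer x - D) = μ := by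
  have h := hD.outer_sub_isHermitian x
  have hne : Nonempty m := by
    by_contra hemp
    rw [not_nonempty_iff] at hemp
    simp at hx
  obtain ⟨k, hk⟩ := Finite.exists_max h.eigenvalues
  have hgr : IsGreatest (Set.range h.eigenvalues) (h.eigenvalues k) :=
    ⟨⟨k, rfl⟩, by rintro _ ⟨i, rfl⟩; exact hk i⟩
  have hpos := hD.pos_of_isGreatest hx hnd h hgr
  exact ⟨h.eigenvalues k, ⇑(h.eigenvectorBasis k), hpos,
    by simp [h.star_eigenvectorBasis_dotProduct], h.mulVec_eigenvectorBasis_coe k,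
    hD.norms_eq_of_isGreatest hx h hpos hgr⟩

end Incoherent

theorem mul_norm_add_sq_le {f M ε : ℝ} (hf : |f| ≤ M) (hε : 0 < ε) (a b : ℂ) :
    f * ‖a + b‖ ^ 2 ≤ (f + ε / 2) * ‖a‖ ^ 2 + (M + 2 * M ^ 2 / ε) * ‖b‖ ^ 2 := by
  have h1 : ‖a + b‖ ^ 2 = ‖a‖ ^ 2 + ‖b‖ ^ 2 + 2 * (a * (starRingEnd ℂ) b).re := by
    simp only [← Complex.normSq_eq_norm_sq, Complex.normSq_add]
  have h2 : |(a * (starRingEnd ℂ) b).re| ≤ ‖a‖ * ‖b‖ := by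
    simpa using Complex.abs_re_le_norm (a * (starRingEnd ℂ) b)
  have h3 : f * (a * (starRingEnd ℂ) b).re ≤ M * (‖a‖ * ‖b‖) := by
    refine (le_abs_self _).trans ?_
    rw [abs_mul]
    exact mul_le_mul hf h2 (abs_nonneg _) ((abs_nonneg _).trans hf)
  have h4 : 2 * (M * (‖a‖ * ‖b‖)) ≤ ε / 2 * ‖a‖ ^ 2 + 2 * M ^ 2 / ε * ‖b‖ ^ 2 := by
    have : ε / 2 * ‖a‖ ^ 2 + 2 * M ^ 2 / ε * ‖b‖ ^ 2 - 2 * (M * (‖a‖ * ‖b‖))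
        = (ε * ‖a‖ - 2 * M * ‖b‖) ^ 2 / (2 * ε) := by
      field_simp
      ring
    have h5 : 0 ≤ (ε * ‖a‖ - 2 * M * ‖b‖) ^ 2 / (2 * ε) := by positivity
    linarith
  have h5 : f * ‖b‖ ^ 2 ≤ M * ‖b‖ ^ 2 :=
    mul_le_mul_of_nonneg_right ((le_abs_self f).trans hf) (by positivity)
  rw [h1]
  linarith

/-- A diagonal perturbation that decreases the quadratic form at the top eigenvector decreases it
below the top eigenvalue on the whole unit sphere, once it is scaled down enough. -/
theorem exists_pos_forall_re_dotProduct_lt {m : Type*} [Fintype m] [DecidableEq m]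
    {D : Matrix m m ℂ} (hD : D.PosSemidef) {x v : m → ℂ} (hA : (outer x - D).IsHermitian)
    {μ : ℝ} (hμ : 0 < μ) (hv : ∑ i, ‖v i‖ ^ 2 = 1) (hev : (outer x - D) *ᵥ v = (μ : ℂ) • v)
    {f : m → ℝ} (hf : ∑ j, f j * ‖v j‖ ^ 2 < 0) :
    ∃ t : ℝ, 0 < t ∧ t ≤ 1 ∧ ∀ u : m → ℂ, ∑ i, ‖u i‖ ^ 2 = 1 →
      (star u ⬝ᵥ (outer x - D) *ᵥ u).re + t * ∑ j, f j * ‖u j‖ ^ 2 < μ := by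
  have hv' : star v ⬝ᵥ v = 1 := by rw [star_dotProduct_self_eq_sum, hv, Complex.ofReal_one]
  obtain ⟨ε, hε, hfε⟩ : ∃ ε > 0, ∑ j, f j * ‖v j‖ ^ 2 = -ε := ⟨_, neg_pos.2 hf, (neg_neg _).symm⟩
  set M := ∑ j, |f j|
  have hM : ∀ j, |f j| ≤ M := fun j =>
    Finset.single_le_sum (f := fun j => |f j|) (fun _ _ => abs_nonneg _) (Finset.mem_univ j)
  set K := M + 2 * M ^ 2 / ε
  have hK : 0 ≤ K := by positivity
  have hbound : ∀ (c : ℂ) (w : m → ℂ), ∑ j, f j * ‖(c • v + w) j‖ ^ 2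
      ≤ -(ε / 2) * ‖c‖ ^ 2 + K * ∑ j, ‖w j‖ ^ 2 := by
    intro c w
    calc ∑ j, f j * ‖(c • v + w) j‖ ^ 2
        ≤ ∑ j, ((f j + ε / 2) * ‖c * v j‖ ^ 2 + K * ‖w j‖ ^ 2) :=
          Finset.sum_le_sum fun j _ => mul_norm_add_sq_le (hM j) hε _ _
      _ = ‖c‖ ^ 2 * (∑ j, f j * ‖v j‖ ^ 2) + ε / 2 * ‖c‖ ^ 2 * (∑ j, ‖v j‖ ^ 2)
          + K * ∑ j, ‖w j‖ ^ 2 := by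
          simp only [Finset.mul_sum, ← Finset.sum_add_distrib, norm_mul]
          exact Finset.sum_congr rfl fun j _ => by ring
      _ = _ := by rw [hfε, hv]; ring
  refine ⟨min 1 (μ / (K + 1) / 2), by positivity, min_le_left _ _, fun u hu => ?_⟩
  have ht : 0 < min 1 (μ / (K + 1) / 2) := by positivity
  have htK : min 1 (μ / (K + 1) / 2) * K < μ := by
    calc min 1 (μ / (K + 1) / 2) * K ≤ μ / (K + 1) / 2 * (K + 1) :=
          mul_le_mul (min_le_right _ _) (by linarith) hK (by positivity)
      _ = μ / 2 := by field_simp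
      _ < μ := by linarith
  generalize min 1 (μ / (K + 1) / 2) = t at ht htK
  obtain ⟨c, w, rfl, hvw, hwv, hsum⟩ := exists_orthogonal_decomposition hv' u
  rw [hA.dotProduct_mulVec_add_of_orthogonal hv' hev hvw hwv]
  have h1 := hA.re_dotProduct_mulVec_nonpos_of_orthogonal hμ hv' hev
    (fun y hy => re_dotProduct_outer_sub_mulVec_nonpos hD hy) hvw
  have h2 := mul_le_mul_of_nonneg_left (hbound c w) ht.le
  have h3 : 0 ≤ ∑ i, ‖w i‖ ^ 2 := by positivity
  rw [hu] at hsum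
  generalize ∑ i, ‖w i‖ ^ 2 = r at h2 h3 hsum
  have hc : ‖c‖ ^ 2 = 1 - r := by linarith
  have hc0 : 0 ≤ 1 - r := hc ▸ sq_nonneg ‖c‖
  rw [hc] at h2 ⊢
  have htε : 0 < t * (ε / 2) := by positivity
  rcases h3.eq_or_lt with rfl | hr
  · linarith
  · nlinarith [mul_pos (sub_pos.2 htK) hr, mul_nonneg htε.le hc0]

/-- for a non-diagonal pure state `|x⟩⟨x|`, an incoherent state `D`, and a
unit eigenvector `v` of `|x⟩⟨x| - D` for its largest eigenvalue, the following are
equivalent: (a) `D` minimizes the trace-norm distance to `|x⟩⟨x|` among incoherent states;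
(b) `D` minimizes the operator-norm distance; (c) `⟨v|F|v⟩ ≥ 0` for every diagonal real `F`
with `∑ f j = 0` and `f j ≤ D j j`. -/
theorem stmt2 {n : ℕ} (x : Fin n → ℂ) (hx : ∑ i, ‖x i‖ ^ 2 = 1)
    (hnd : ¬ ∃ dvec : Fin n → ℂ, outer x = Matrix.diagonal dvec)
    (D : Matrix (Fin n) (Fin n) ℂ) (hD : IsIncoherent D)
    (h : (outer x - D).IsHermitian)
    (lam : ℝ) (hlam : IsGreatest (Set.range h.eigenvalues) lam)
    (v : Fin n → ℂ) (hv : ∑ i, ‖v i‖ ^ 2 = 1)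
    (hev : (outer x - D).mulVec v = (lam : ℂ) • v) :
    List.TFAE [
      ∀ δ, IsIncoherent δ → traceNorm (outer x - D) ≤ traceNorm (outer x - δ),
      ∀ δ, IsIncoherent δ → opNorm (outer x - D) ≤ opNorm (outer x - δ),
      ∀ f : Fin n → ℝ, (∑ j, f j = 0) → (∀ j, (f j : ℂ) ≤ D j j) →
        0 ≤ star v ⬝ᵥ (Matrix.diagonal fun j => (f j : ℂ)).mulVec v] := by
  have hpos := hD.pos_of_isGreatest hx hnd h hlam
  have hnorms := hD.norms_eq_of_isGreatest hx h hpos hlam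
  have hDre : ∀ j, D j j = ((D j j).re : ℂ) := fun j =>
    (hD.1.1.isHermitian.coe_re_apply_self j).symm
  tfae_have 1 ↔ 2 := by
    refine forall₂_congr fun δ hδ => ?_
    obtain ⟨μ, -, -, -, -, htr, hop⟩ := hδ.exists_eigenvector hx hnd
    rw [hnorms.1, hnorms.2, htr, hop, mul_le_mul_iff_right₀ two_pos]
  tfae_have 2 → 3 := by
    intro hmin f hf0 hfD
    rw [star_dotProduct_diagonal_mulVec, Complex.zero_le_real]
    by_contra! hneg
    obtain ⟨t, ht0, ht1, hlt⟩ :=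
      exists_pos_forall_re_dotProduct_lt hD.1.1 h hpos hv hev hneg
    have hδ : IsIncoherent (diagonal fun j => D j j - ((t * f j : ℝ) : ℂ)) := by
      refine isIncoherent_diagonal (fun j => ?_) ?_
      · have hD0 : 0 ≤ (D j j).re := (Complex.le_def.1 hD.1.1.diag_nonneg).1
        have hfj : f j ≤ (D j j).re := (Complex.le_def.1 (hfD j)).1
        rw [hDre j, ← Complex.ofReal_sub, Complex.zero_le_real]
        nlinarith
      · rw [Finset.sum_sub_distrib, ← Complex.ofReal_sum, ← Finset.mul_sum, hf0, mul_zero,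
          Complex.ofReal_zero, sub_zero]
        exact hD.1.2
    have hle := hmin _ hδ
    obtain ⟨μ, u, -, hu, heu, -, hop⟩ := hδ.exists_eigenvector hx hnd
    rw [hnorms.2, hop] at hle
    have hu1 : ∑ i, ‖u i‖ ^ 2 = 1 := by
      rw [star_dotProduct_self_eq_sum] at hu
      exact_mod_cast hu
    have hsplit : outer x - (diagonal fun j => D j j - ((t * f j : ℝ) : ℂ))
        = (outer x - D) + diagonal fun j => ((t * f j : ℝ) : ℂ) := by
      rw [← diagonal_sub, ← hD.eq_diagonal]
      abel
    have hval : (star u ⬝ᵥ (outer x - D) *ᵥ u).re + t * ∑ j, f j * ‖u j‖ ^ 2 = μ := by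
      have := congrArg (fun y => (star u ⬝ᵥ y).re) heu
      simp only [hsplit, add_mulVec, dotProduct_add, star_dotProduct_diagonal_mulVec,
        dotProduct_smul, hu, Complex.add_re, Complex.ofReal_re, smul_eq_mul, mul_one,
        mul_assoc, ← Finset.mul_sum] at this
      exact this
    linarith [hlt u hu1]
  tfae_have 3 → 2 := by
    intro hF δ hδ
    obtain ⟨μ, u, hμ, hu, heu, -, hop⟩ := hδ.exists_eigenvector hx hnd
    rw [hnorms.2, hop]
    have hδre : ∀ j, δ j j = ((δ j j).re : ℂ) := fun j =>
      (hδ.1.1.isHermitian.coe_re_apply_self j).symm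
    have hF' := hF (fun j => (D j j).re - (δ j j).re) (by
      have h1 := congrArg Complex.re hD.1.2
      have h2 := congrArg Complex.re hδ.1.2
      simp only [trace, diag_apply, Complex.re_sum] at h1 h2
      rw [Finset.sum_sub_distrib, h1, h2, sub_self]) (fun j => by
      have hδ0 : 0 ≤ (δ j j).re := (Complex.le_def.1 hδ.1.1.diag_nonneg).1
      rw [hDre j, Complex.real_le_real]
      simpa using hδ0)
    have hdiag : (diagonal fun j => (((D j j).re - (δ j j).re : ℝ) : ℂ)) = D - δ := by
      conv_rhs => rw [hD.eq_diagonal, hδ.eq_diagonal, diagonal_sub]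
      congr 1
      ext j
      rw [hDre j, hδre j]
      simp
    rw [hdiag] at hF'
    have hle := re_dotProduct_outer_sub_mulVec_le hδ.1.1 (hδ.outer_sub_isHermitian x) hμ hu heu v hv
    have hsplit : outer x - δ = (outer x - D) + (D - δ) := by abel
    rw [hsplit, add_mulVec, dotProduct_add, hev, dotProduct_smul, star_dotProduct_self_eq_sum, hv,
      Complex.add_re] at hle
    have := (Complex.le_def.1 hF').1
    simp at this hle
    linarith
  tfae_finish
end

section
/- Let x = (x_1, …, x_n) be a real unit vector with x_1 ≥ x_2 ≥ … ≥ x_n ≥ 0, and let k be the maximum element of { ℓ ∈ {1, …, n} : x_ℓ > q_ℓ }. If k < n, then q_k ≥ x_{k+1}. -/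
open Matrix BigOperators
open scoped ComplexOrder

/-- `ent x ℓ` is the 1-based entry `x_ℓ` of `x` (junk value `0` outside `{1,…,n}`). -/
noncomputable def ent {n : ℕ} (x : Fin n → ℝ) (ℓ : ℕ) : ℝ :=
  if h : 1 ≤ ℓ ∧ ℓ ≤ n then x ⟨ℓ - 1, by omega⟩ else 0

/-- `s_ℓ = ∑_{j=1}^{ℓ} x_j`. -/
noncomputable def sVal {n : ℕ} (x : Fin n → ℝ) (ℓ : ℕ) : ℝ :=
  ∑ j ∈ Finset.Icc 1 ℓ, ent x j

/-- `m_ℓ = ∑_{j=ℓ+1}^{n} x_j²`. -/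
noncomputable def mVal {n : ℕ} (x : Fin n → ℝ) (ℓ : ℕ) : ℝ :=
  ∑ j ∈ Finset.Icc (ℓ + 1) n, (ent x j) ^ 2

/-- `p_ℓ = s_ℓ² − 1 − ℓ·m_ℓ`. -/
noncomputable def pVal {n : ℕ} (x : Fin n → ℝ) (ℓ : ℕ) : ℝ :=
  (sVal x ℓ) ^ 2 - 1 - ℓ * mVal x ℓ

/-- `q_ℓ = (p_ℓ + √(p_ℓ² + 4·ℓ·m_ℓ·s_ℓ²)) / (2·ℓ·s_ℓ)`. -/
noncomputable def qVal {n : ℕ} (x : Fin n → ℝ) (ℓ : ℕ) : ℝ :=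
  (pVal x ℓ + Real.sqrt ((pVal x ℓ) ^ 2 + 4 * ℓ * mVal x ℓ * (sVal x ℓ) ^ 2)) /
    (2 * ℓ * sVal x ℓ)

/-- The larger root of `ℓ s t² - (s² - 1 - ℓ m) t - m s = (ℓ t - s) (s t + m) + t` bounds `t ≥ 0`
from above exactly when the quadratic is nonpositive at `t`. -/
lemma le_quadratic_root_iff {l s m t : ℝ} (hl : 0 < l) (hs : 0 < s) (hm : 0 ≤ m) (ht : 0 ≤ t) :
    t ≤ ((s ^ 2 - 1 - l * m) + √((s ^ 2 - 1 - l * m) ^ 2 + 4 * l * m * s ^ 2)) / (2 * l * s) ↔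
      (l * t - s) * (s * t + m) + t ≤ 0 := by
  set p := s ^ 2 - 1 - l * m with hp
  have hls : 0 < l * s := mul_pos hl hs
  have hD : p ^ 2 ≤ p ^ 2 + 4 * l * m * s ^ 2 := by
    have : 0 ≤ 4 * l * m * s ^ 2 := by positivity
    linarith
  have key : (2 * l * s * t - p) ^ 2 =
      4 * (l * s) * ((l * t - s) * (s * t + m) + t) + (p ^ 2 + 4 * l * m * s ^ 2) := by
    rw [hp]; ring
  rw [le_div_iff₀ (by positivity)]
  constructor
  · intro h
    have hp' : p ≤ √(p ^ 2 + 4 * l * m * s ^ 2) := Real.le_sqrt_of_sq_le hD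
    have ht' : 0 ≤ 2 * (l * s) * t := by positivity
    have hsq : (2 * l * s * t - p) ^ 2 ≤ √(p ^ 2 + 4 * l * m * s ^ 2) ^ 2 :=
      sq_le_sq' (by linarith) (by linarith)
    rw [Real.sq_sqrt ((sq_nonneg p).trans hD), key] at hsq
    by_contra! hf
    have := mul_pos hls hf
    linarith
  · intro h
    have hf := mul_nonpos_of_nonneg_of_nonpos hls.le h
    have := Real.le_sqrt_of_sq_le (x := 2 * l * s * t - p) (y := p ^ 2 + 4 * l * m * s ^ 2)
      (by linarith)
    linarith

lemma ent_nonneg {n : ℕ} {x : Fin n → ℝ} (hnonneg : ∀ j, 0 ≤ x j) (l : ℕ) : 0 ≤ ent x l := by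
  unfold ent
  split_ifs
  · exact hnonneg _
  · exact le_rfl

lemma mVal_nonneg {n : ℕ} (x : Fin n → ℝ) (l : ℕ) : 0 ≤ mVal x l :=
  Finset.sum_nonneg fun _ _ => sq_nonneg _

lemma sVal_pos {n : ℕ} {x : Fin n → ℝ} (hunit : ∑ j, (x j) ^ 2 = 1)
    (hmono : ∀ i j : Fin n, i ≤ j → x j ≤ x i) (hnonneg : ∀ j, 0 ≤ x j)
    (hn : 1 ≤ n) {l : ℕ} (hl : 1 ≤ l) : 0 < sVal x l := by
  have hfirst : 0 < ent x 1 := by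
    refine (ent_nonneg hnonneg 1).lt_of_ne' fun h => ?_
    rw [ent, dif_pos ⟨le_rfl, hn⟩] at h
    have hzero (j : Fin n) : x j = 0 :=
      le_antisymm (h ▸ hmono ⟨0, hn⟩ j (Nat.zero_le _)) (hnonneg j)
    simp [hzero] at hunit
  exact hfirst.trans_le <| Finset.single_le_sum (f := ent x)
    (fun j _ => ent_nonneg hnonneg j) (Finset.mem_Icc.2 ⟨le_rfl, hl⟩)

lemma sVal_succ {n : ℕ} (x : Fin n → ℝ) (l : ℕ) : sVal x (l + 1) = sVal x l + ent x (l + 1) :=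
  Finset.sum_Icc_succ_top (Nat.le_add_left 1 l) _

lemma mVal_eq_sq_add {n : ℕ} (x : Fin n → ℝ) {l : ℕ} (hl : l < n) :
    mVal x l = ent x (l + 1) ^ 2 + mVal x (l + 1) := by
  unfold mVal
  rw [← Finset.insert_Icc_add_one_left_eq_Icc hl, Finset.sum_insert (by simp)]

/-- with `k` the maximal index in `{1,…,n}` with `x_k > q_k`, if `k < n`
then `q_k ≥ x_{k+1}`. -/
theorem stmt7 {n : ℕ} (hn : 1 ≤ n) (x : Fin n → ℝ)
    (hunit : ∑ j, (x j) ^ 2 = 1)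
    (hmono : ∀ i j : Fin n, i ≤ j → x j ≤ x i)
    (hnonneg : ∀ j, 0 ≤ x j)
    (k : ℕ) (hk : k ∈ Finset.Icc 1 n) (hkq : qVal x k < ent x k)
    (hkmax : ∀ ℓ ∈ Finset.Icc 1 n, qVal x ℓ < ent x ℓ → ℓ ≤ k)
    (hklt : k < n) :
    ent x (k + 1) ≤ qVal x k := by
  obtain ⟨hk1, -⟩ := Finset.mem_Icc.1 hk
  have hy : ent x (k + 1) ≤ qVal x (k + 1) := by
    by_contra! h
    have := hkmax (k + 1) (Finset.mem_Icc.2 ⟨by omega, hklt⟩) h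
    omega
  have hy0 := ent_nonneg hnonneg (k + 1)
  unfold qVal pVal at hy ⊢
  rw [le_quadratic_root_iff (by positivity) (sVal_pos hunit hmono hnonneg hn (by omega))
    (mVal_nonneg x _) hy0, sVal_succ] at hy
  rw [le_quadratic_root_iff (by positivity) (sVal_pos hunit hmono hnonneg hn hk1)
    (mVal_nonneg x _) hy0, mVal_eq_sq_add x hklt]
  push_cast at hy
  linarith
end
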